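/- In the ternary Thue–Morse sequence A (the fixed point of φ starting with a), the letters a and c alternate when all occurrences of b are deleted: if (n_i)_{i≥0} is the increasing enumeration of the set {n : A(n) ≠ b}, then A(n_i) = a whenever i is even and A(n_i) = c whenever i is odd. (Consequently, deleting all b's from A and reinserting a b before each c transforms A into the periodic word (abc)^ω.) -/

import Mathlib

/-- The substitution φ on the alphabet {a,b,c} (encoded as `Fin 3` with
a = 0, b = 1, c = 2): a ↦ abc, b ↦ ac, c ↦ b. -/
def phi : Fin 3 → List (Fin 3) := ![[0, 1, 2], [0, 2], [1]]

/-- The ternary Thue–Morse sequence A, the infinite fixed point of φ starting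
with a: the n-th letter of φ^k(a) for any k large enough (the word
φ^(n+1)(a) has length > n). -/
def ternTM (n : ℕ) : Fin 3 := ((fun w => w.flatMap phi)^[n + 1] [0]).getD n 0

/-- The word `φ^k(w)`. -/
def phiIter (k : ℕ) (w : List (Fin 3)) : List (Fin 3) := (fun w => w.flatMap phi)^[k] w

lemma phiIter_succ (k : ℕ) (w : List (Fin 3)) :
    phiIter (k + 1) w = (phiIter k w).flatMap phi := by
  simp [phiIter, Function.iterate_succ_apply']

lemma phiIter_append (k : ℕ) (u v : List (Fin 3)) :
    phiIter k (u ++ v) = phiIter k u ++ phiIter k v := by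
  induction k with
  | zero => rfl
  | succ k ih => simp [phiIter_succ, ih]

lemma phiIter_step (k : ℕ) :
    phiIter (k + 1) [0] = phiIter k [0] ++ phiIter k [1, 2] := by
  rw [← phiIter_append]
  simp [phiIter, Function.iterate_succ_apply, phi]

lemma phiIter_tail (k : ℕ) : ∃ x ∈ phiIter (k + 1) [1, 2], x = 0 := by
  induction k with
  | zero => exact ⟨0, by simp [phiIter, phi], rfl⟩
  | succ k ih =>
    obtain ⟨x, hx, rfl⟩ := ih
    refine ⟨0, ?_, rfl⟩
    rw [phiIter_succ]
    exact List.mem_flatMap.2 ⟨0, hx, by simp [phi]⟩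

lemma phiIter_length (k : ℕ) : k < (phiIter k [0]).length := by
  induction k with
  | zero => simp [phiIter]
  | succ k ih =>
    rw [phiIter_step, List.length_append]
    have : 0 < (phiIter k [1, 2]).length := by
      cases k with
      | zero => simp [phiIter]
      | succ k =>
        obtain ⟨x, hx, -⟩ := phiIter_tail k
        exact List.length_pos_of_mem hx
    omega

lemma phiIter_prefix {k l : ℕ} (h : k ≤ l) : phiIter k [0] <+: phiIter l [0] := by
  induction l, h using Nat.le_induction with
  | base => exact List.prefix_rfl
  | succ l _ ih => exact ih.trans (by rw [phiIter_step]; exact List.prefix_append _ _)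

lemma ternTM_eq (k n : ℕ) (h : n < (phiIter k [0]).length) :
    (phiIter k [0])[n]? = some (ternTM n) := by
  have h1 : n < (phiIter (n + 1) [0]).length := by
    have := phiIter_length (n + 1); omega
  have h2 : ternTM n = (phiIter (n + 1) [0])[n] := by
    change (phiIter (n + 1) [0]).getD n 0 = _
    simp [List.getD, h1]
  rw [h2, List.getElem?_eq_getElem h]
  rcases le_total k (n + 1) with hk | hk
  · rw [(phiIter_prefix hk).getElem h]
  · rw [(phiIter_prefix hk).getElem h1]

lemma ternTM_infinite : {n | ternTM n ≠ 1}.Infinite := by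
  rw [Set.infinite_iff_exists_gt]
  intro m
  obtain ⟨x, hx, rfl⟩ := phiIter_tail m
  obtain ⟨j, hj⟩ := List.mem_iff_getElem?.1 hx
  have hl := phiIter_length (m + 1)
  have hg : (phiIter (m + 1 + 1) [0])[(phiIter (m + 1) [0]).length + j]? = some 0 := by
    rw [phiIter_step, List.getElem?_append_right (by omega)]
    simpa using hj
  have hlt := (List.getElem?_eq_some_iff.1 hg).1
  rw [ternTM_eq _ _ hlt] at hg
  refine ⟨(phiIter (m + 1) [0]).length + j, ?_, by omega⟩
  have : ternTM ((phiIter (m + 1) [0]).length + j) = 0 := by simpa using hg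
  change ternTM _ ≠ 1
  rw [this]
  decide

lemma filter_flatMap_phi (w : List (Fin 3)) : (w.flatMap phi).filter (fun x => x ≠ 1) =
    (w.filter (fun x => x ≠ 2)).flatMap (fun _ => [0, 2]) := by
  induction w with
  | nil => rfl
  | cons x w ih =>
    rw [List.flatMap_cons, List.filter_append, ih]
    fin_cases x <;> simp [phi]

lemma alternating (l : List (Fin 3)) : ∀ (j : ℕ) (x : Fin 3),
    (l.flatMap (fun _ => [(0 : Fin 3), 2]))[j]? = some x → x = if Even j then 0 else 2 := by
  induction l with
  | nil => simp
  | cons y l ih =>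
    intro j x h
    match j with
    | 0 => simpa using h.symm
    | 1 => simpa using h.symm
    | j + 2 =>
      have := ih j x (by simpa using h)
      simpa [Nat.even_add] using this

lemma count_eq (n : ℕ) : Nat.count (fun n => ternTM n ≠ 1) n =
    (((List.range n).map ternTM).filter (fun x => x ≠ 1)).length := by
  induction n with
  | zero => simp
  | succ n ih =>
    rw [Nat.count_succ, ih, List.range_succ, List.map_append, List.filter_append]
    by_cases h : ternTM n = 1 <;> simp [h]

lemma map_prefix (n : ℕ) : (List.range n).map ternTM <+: phiIter (n + 1) [0] := by
  rw [List.prefix_iff_eq_take]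
  have hl := phiIter_length (n + 1)
  apply List.ext_getElem?
  intro i
  rw [List.getElem?_take]
  by_cases hi : i < n
  · rw [ternTM_eq (n + 1) i (by omega)]
    simp [hi]
  · simp [hi]

lemma ternTM_of_ne (n : ℕ) (h : ternTM n ≠ 1) :
    ternTM n = if Even (Nat.count (fun n => ternTM n ≠ 1) n) then 0 else 2 := by
  have hp := (map_prefix (n + 1)).filter (fun x => decide (x ≠ 1))
  rw [phiIter_succ, filter_flatMap_phi] at hp
  apply alternating ((phiIter (n + 1) [0]).filter (fun x => decide (x ≠ 2)))
  rw [count_eq]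
  obtain ⟨t, ht⟩ := hp
  rw [← ht, List.range_succ, List.map_append, List.filter_append]
  simp [h]

theorem a_and_c_alternate_after_deleting_b :
    ∀ i : ℕ,
      (Even i → ternTM (Nat.nth (fun n => ternTM n ≠ 1) i) = 0) ∧
      (Odd i → ternTM (Nat.nth (fun n => ternTM n ≠ 1) i) = 2) := by
  intro i
  have h1 := Nat.nth_mem_of_infinite ternTM_infinite i
  have h2 := ternTM_of_ne _ h1
  rw [Nat.count_nth_of_infinite ternTM_infinite] at h2
  refine ⟨fun h => ?_, fun h => ?_⟩
  · rw [h2, if_pos h]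
  · rw [h2, if_neg (Nat.not_even_iff_odd.2 h)]
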